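/- arXiv:1912.11307 — 2 statements merged into one kernel-verified Lean document; each statement's English description precedes it below -/
import Mathlib

section
/- Let (M,φ) be a flow on a compact metric space M. Then the flow (M,φ) has a weak horseshoe with bounded-gap-hitting times if and only if the time-one map (M,φ_1) has a weak horseshoe with bounded-gap-hitting times. -/
/-- A homeomorphism (given as a bijection `T` of a topological space) has a *weak horseshoe
with bounded-gap-hitting times* if there are two disjoint nonempty closed subsets `U 0, U 1`,
a constant `K > 0` and a subset `J = {n i}_{i ∈ ℤ}` of `ℤ` with `0 < n (i+1) - n i < K`
for all `i`, such that for every `s ∈ {0,1}^J` there is `x` with `T^j x ∈ U (s j)` for all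
`j ∈ J`. -/
def HasWeakHorseshoeBGH {X : Type*} [TopologicalSpace X] (T : Equiv.Perm X) : Prop :=
  ∃ (U : Fin 2 → Set X) (K : ℤ) (n : ℤ → ℤ),
    (∀ k, IsClosed (U k)) ∧ (∀ k, (U k).Nonempty) ∧ Disjoint (U 0) (U 1) ∧
    0 < K ∧ (∀ i : ℤ, 0 < n (i + 1) - n i ∧ n (i + 1) - n i < K) ∧
    ∀ s : ℤ → Fin 2, ∃ x : X, ∀ i : ℤ, (T ^ n i) x ∈ U (s (n i))

/-- The time-`t` map of a flow `φ`, as a bijection of the phase space. -/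
def flowMap {M : Type*} (φ : M × ℝ → M) (h0 : ∀ x, φ (x, 0) = x)
    (hadd : ∀ (x : M) (t s : ℝ), φ (φ (x, s), t) = φ (x, t + s)) (t : ℝ) :
    Equiv.Perm M where
  toFun x := φ (x, t)
  invFun x := φ (x, -t)
  left_inv x := by
    show φ (φ (x, t), -t) = x
    rw [hadd]; simp [h0]
  right_inv x := by
    show φ (φ (x, -t), t) = x
    rw [hadd]; simp [h0]

/-- A flow `φ` has a *weak horseshoe with bounded-gap-hitting times* if there are two
disjoint nonempty closed subsets `U 0, U 1`, constants `K > 0` and `L > 0`, and a subset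
`J = {t i}_{i ∈ ℤ}` of `ℝ` with `L < t (i+1) - t i < K` for all `i`, such that for every
`s ∈ {0,1}^J` there is `x` with `φ (x, j) ∈ U (s j)` for all `j ∈ J`. -/
def FlowHasWeakHorseshoeBGH {M : Type*} [TopologicalSpace M] (φ : M × ℝ → M) : Prop :=
  ∃ (U : Fin 2 → Set M) (K L : ℝ) (t : ℤ → ℝ),
    (∀ k, IsClosed (U k)) ∧ (∀ k, (U k).Nonempty) ∧ Disjoint (U 0) (U 1) ∧
    0 < K ∧ 0 < L ∧ (∀ i : ℤ, L < t (i + 1) - t i ∧ t (i + 1) - t i < K) ∧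
    ∀ s : ℝ → Fin 2, ∃ x : M, ∀ i : ℤ, φ (x, t i) ∈ U (s (t i))

/-- A set of integers is *piecewise syndetic* if for some `K` there are arbitrarily long
intervals in which every subinterval of length `K` meets the set. -/
def IsPiecewiseSyndetic (A : Set ℤ) : Prop :=
  ∃ K : ℤ, ∀ N : ℤ, ∃ a : ℤ, ∀ b, a ≤ b → b + K ≤ a + N → ∃ j ∈ A, b ≤ j ∧ j < b + K

theorem IsPiecewiseSyndetic.union {A B : Set ℤ} (h : IsPiecewiseSyndetic (A ∪ B)) :
    IsPiecewiseSyndetic A ∨ IsPiecewiseSyndetic B := by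
  by_contra! hcon
  obtain ⟨hA, hB⟩ := hcon
  obtain ⟨K, hK⟩ := h
  refine hB ⟨K, fun N => ?_⟩
  unfold IsPiecewiseSyndetic at hA
  push Not at hA
  obtain ⟨N', hN'⟩ := hA N
  obtain ⟨a, ha⟩ := hK N'
  obtain ⟨b, hab, hbN, hb⟩ := hN' a
  refine ⟨b, fun b' hb' hb'N => ?_⟩
  obtain ⟨j, hj | hj, h1, h2⟩ := ha b' (by omega) (by omega)
  · have := hb j hj (by omega)
    omega
  · exact ⟨j, hj, h1, h2⟩

theorem IsPiecewiseSyndetic.exists_of_biUnion {ι : Type*} (F : Finset ι) (A : ι → Set ℤ)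
    (h : IsPiecewiseSyndetic (⋃ c ∈ F, A c)) : ∃ c ∈ F, IsPiecewiseSyndetic (A c) := by
  classical
  induction F using Finset.induction_on with
  | empty =>
    obtain ⟨K, hK⟩ := h
    obtain ⟨a, ha⟩ := hK K
    obtain ⟨j, hj, -⟩ := ha a le_rfl le_rfl
    simp at hj
  | insert c F _ ih =>
    rw [Finset.set_biUnion_insert] at h
    rcases h.union with h | h
    · exact ⟨c, Finset.mem_insert_self c F, h⟩
    · obtain ⟨d, hd, hAd⟩ := ih h
      exact ⟨d, Finset.mem_insert_of_mem hd, hAd⟩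

theorem flowMap_one_zpow {M : Type*} (φ : M × ℝ → M) (h0 : ∀ x, φ (x, 0) = x)
    (hadd : ∀ (x : M) (t s : ℝ), φ (φ (x, s), t) = φ (x, t + s)) (n : ℤ) (x : M) :
    (flowMap φ h0 hadd 1 ^ n) x = φ (x, n) := by
  induction n using Int.induction_on generalizing x with
  | zero => simp [h0]
  | succ n ih =>
    rw [zpow_add_one, Equiv.Perm.mul_apply, ih]
    change φ (φ (x, 1), _) = _
    rw [hadd]
    push_cast
    rfl
  | pred n ih =>
    rw [zpow_sub_one, Equiv.Perm.mul_apply, ih]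
    change φ (φ (x, -1), _) = _
    rw [hadd]
    push_cast
    rfl

/-- A real sequence with gaps in `(L, K)`, `L > 0`, meets every interval of length `K`. -/
theorem exists_mem_Ico_of_gaps {K L : ℝ} {t : ℤ → ℝ} (hL : 0 < L)
    (ht : ∀ i : ℤ, L < t (i + 1) - t i ∧ t (i + 1) - t i < K) (a : ℝ) :
    ∃ i, t i ∈ Set.Ico a (a + K) := by
  have hmono : StrictMono t := strictMono_int_of_lt_succ fun i => by linarith [(ht i).1]
  have hup : ∀ n : ℕ, t 0 + n * L ≤ t n := by
    intro n
    induction n with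
    | zero => simp
    | succ n ih =>
      have := (ht n).1
      push_cast
      linarith
  have hdown : ∀ n : ℕ, t (-n) ≤ t 0 - n * L := by
    intro n
    induction n with
    | zero => simp
    | succ n ih =>
      have := (ht (-n - 1)).1
      rw [sub_add_cancel] at this
      push_cast
      rw [neg_add, ← sub_eq_add_neg]
      linarith
  obtain ⟨p, hp⟩ := exists_nat_gt ((a - t 0) / L)
  obtain ⟨q, hq⟩ := exists_nat_gt ((t 0 - a) / L)
  rw [div_lt_iff₀ hL] at hp hq
  obtain ⟨i, hi, hmin⟩ := Int.exists_least_of_bdd (P := fun i => a ≤ t i)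
    ⟨-q, fun z hz => by
      by_contra! h
      have := hmono h
      linarith [hdown q]⟩ ⟨p, by linarith [hup p]⟩
  refine ⟨i, hi, ?_⟩
  have h1 : t (i - 1) < a := by
    by_contra! h
    have := hmin _ h
    omega
  have h2 := (ht (i - 1)).2
  rw [sub_add_cancel] at h2
  linarith

/-- If the itineraries through two closed sets are free along a piecewise syndetic set of
integer times, then the time-one map has a weak horseshoe with bounded-gap-hitting times. -/
theorem hasWeakHorseshoeBGH_of_isPiecewiseSyndetic {M : Type*} [TopologicalSpace M]
    [CompactSpace M] (φ : M × ℝ → M) (hφ : Continuous φ) (h0 : ∀ x, φ (x, 0) = x)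
    (hadd : ∀ (x : M) (t s : ℝ), φ (φ (x, s), t) = φ (x, t + s))
    {V : Fin 2 → Set M} (hVc : ∀ k, IsClosed (V k)) (hVn : ∀ k, (V k).Nonempty)
    (hVd : Disjoint (V 0) (V 1)) {A : Set ℤ} (hA : IsPiecewiseSyndetic A)
    (hs : ∀ s : ℤ → Fin 2, ∃ x : M, ∀ j ∈ A, φ (x, (j : ℝ)) ∈ V (s j)) :
    HasWeakHorseshoeBGH (flowMap φ h0 hadd 1) := by
  obtain ⟨K, hK⟩ := hA
  choose a ha using fun N : ℕ => hK (2 * N)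
  let l : Ultrafilter ℕ := Filter.hyperfilter ℕ
  have hl : (l : Filter ℕ) ≤ Filter.atTop := by
    rw [← Nat.cofinite_eq_atTop]
    exact Filter.hyperfilter_le_cofinite
  let B : Set ℤ := {m | ∀ᶠ N in (l : Filter ℕ), m + (a N + N) ∈ A}
  have hB : ∀ b : ℤ, ∃ m ∈ B, b ≤ m ∧ m < b + K := by
    intro b
    have hev : ∀ᶠ N in (l : Filter ℕ), ∃ m ∈ Set.Ico b (b + K), m + (a N + N) ∈ A := by
      filter_upwards [hl (Filter.eventually_ge_atTop (b.natAbs + (b + K).natAbs))] with N hN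
      obtain ⟨j, hj, h1, h2⟩ := ha N (b + (a N + N)) (by omega) (by omega)
      refine ⟨j - (a N + N), ⟨by omega, by omega⟩, ?_⟩
      rwa [sub_add_cancel]
    obtain ⟨m, hm, hmB⟩ :=
      (Ultrafilter.eventually_exists_mem_iff (Set.finite_Ico b (b + K))).1 hev
    exact ⟨m, hmB, hm⟩
  have hKpos : 0 < K := by
    obtain ⟨m, -, h1, h2⟩ := hB 0
    omega
  choose n hnB hn1 hn2 using fun i : ℤ => hB (2 * K * i)
  refine ⟨V, 3 * K, n, hVc, hVn, hVd, by omega, fun i => ?_, fun s => ?_⟩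
  · have h1 := hn1 i
    have h2 := hn2 i
    have h3 := hn1 (i + 1)
    have h4 := hn2 (i + 1)
    rw [mul_add] at h3 h4
    constructor <;> linarith
  · choose x hx using fun N : ℕ => hs fun j => s (j - (a N + N))
    let y : ℕ → M := fun N => φ (x N, ((a N + N : ℤ) : ℝ))
    obtain ⟨z, -, hz⟩ := isCompact_univ.ultrafilter_le_nhds (l.map y) (by simp)
    have hz : Filter.Tendsto y l (nhds z) := hz
    refine ⟨z, fun i => ?_⟩
    rw [flowMap_one_zpow]
    have hcont : Continuous fun w => φ (w, (n i : ℝ)) := by fun_prop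
    refine (hVc _).mem_of_tendsto ((hcont.tendsto z).comp hz) ?_
    filter_upwards [hnB i] with N hN
    have := hx N _ hN
    rw [add_sub_cancel_right] at this
    simpa [y, hadd] using this

/-- Disjoint compact sets stay disjoint under small time shifts along a flow. -/
theorem exists_nat_forall_abs_le_notMem {M : Type*} [TopologicalSpace M] (φ : M × ℝ → M)
    (hφ : Continuous φ) (h0 : ∀ x, φ (x, 0) = x) {C D : Set M} (hC : IsCompact C)
    (hD : IsClosed D) (hCD : Disjoint C D) :
    ∃ m : ℕ, 0 < m ∧ ∀ u ∈ C, ∀ r : ℝ, |r| ≤ 1 / m → φ (u, r) ∉ D := by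
  have hev : ∀ᶠ r in nhds (0 : ℝ), ∀ u ∈ C, φ (u, r) ∉ D := by
    refine hC.eventually_forall_of_forall_eventually fun u hu => ?_
    have hcont : Continuous fun p : ℝ × M => φ (p.2, p.1) := by fun_prop
    refine (hD.isOpen_compl.preimage hcont).mem_nhds ?_
    simpa [h0] using Set.disjoint_left.1 hCD hu
  obtain ⟨ε, hε, hball⟩ := Metric.eventually_nhds_iff.1 hev
  obtain ⟨m, hm⟩ := exists_nat_one_div_lt hε
  refine ⟨m + 1, m.succ_pos, fun u hu r hr => hball ?_ u hu⟩
  rw [Real.dist_eq, sub_zero]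
  push_cast at hr
  exact hr.trans_lt hm

theorem FlowHasWeakHorseshoeBGH.time_one_map {M : Type*} [TopologicalSpace M] [T2Space M]
    [CompactSpace M] {φ : M × ℝ → M} (hφ : Continuous φ) (h0 : ∀ x, φ (x, 0) = x)
    (hadd : ∀ (x : M) (t s : ℝ), φ (φ (x, s), t) = φ (x, t + s))
    (h : FlowHasWeakHorseshoeBGH φ) : HasWeakHorseshoeBGH (flowMap φ h0 hadd 1) := by
  obtain ⟨U, K, L, t, hUc, hUn, hUd, -, hL, ht, hs⟩ := h
  obtain ⟨m, hm, hsep⟩ :=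
    exists_nat_forall_abs_le_notMem φ hφ h0 (hUc 0).isCompact (hUc 1) hUd
  have hm' : (0 : ℝ) < m := by exact_mod_cast hm
  let A : ℕ → Set ℤ := fun c => {j | ∃ i, ⌊t i⌋ = j ∧ ⌊m * Int.fract (t i)⌋₊ = c}
  have hA : IsPiecewiseSyndetic (⋃ c ∈ Finset.range m, A c) := by
    refine ⟨⌈K⌉ + 1, fun N => ⟨0, fun b _ _ => ?_⟩⟩
    obtain ⟨i, hi1, hi2⟩ := exists_mem_Ico_of_gaps hL ht b
    refine ⟨⌊t i⌋, ?_, Int.le_floor.2 hi1, ?_⟩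
    · simp only [Set.mem_iUnion, Finset.mem_range]
      refine ⟨_, ?_, i, rfl, rfl⟩
      rw [Nat.floor_lt (by positivity)]
      nlinarith [Int.fract_lt_one (t i)]
    · rw [Int.floor_lt]
      push_cast
      linarith [Int.le_ceil K]
  obtain ⟨c, -, hc⟩ := hA.exists_of_biUnion
  let I : Set ℝ := Set.Icc (c / m : ℝ) ((c + 1) / m)
  let V : Fin 2 → Set M := fun k => (fun p : M × ℝ => φ (p.1, -p.2)) '' (U k ×ˢ I)
  refine hasWeakHorseshoeBGH_of_isPiecewiseSyndetic φ hφ h0 hadd (V := V) (fun k => ?_)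
    (fun k => ?_) ?_ hc fun s => ?_
  · exact (((hUc k).isCompact.prod isCompact_Icc).image (by fun_prop)).isClosed
  · exact ((hUn k).prod (Set.nonempty_Icc.2 (by gcongr; linarith))).image _
  · rw [Set.disjoint_left]
    rintro _ ⟨⟨u, r⟩, ⟨hu, hr⟩, rfl⟩ ⟨⟨v, q⟩, ⟨hv, hq⟩, huv⟩
    simp only [I, Set.mem_Icc, add_div] at hu hr hv hq huv
    refine hsep u hu (q - r) (abs_le.2 ⟨by linarith, by linarith⟩) ?_
    have := congrArg (fun w => φ (w, q)) huv
    simp only [hadd, add_neg_cancel, h0] at this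
    rw [sub_eq_add_neg, ← this]
    exact hv
  · obtain ⟨x, hx⟩ := hs fun τ => s ⌊τ⌋
    refine ⟨x, ?_⟩
    rintro _ ⟨i, rfl, hi⟩
    have hnn : 0 ≤ m * Int.fract (t i) := by positivity
    obtain ⟨h1, h2⟩ := (Nat.floor_eq_iff hnn).1 hi
    refine ⟨(φ (x, t i), Int.fract (t i)), ⟨hx i, ?_, ?_⟩, ?_⟩
    · rw [div_le_iff₀ hm']
      linarith
    · rw [le_div_iff₀ hm']
      linarith
    · simp only [hadd]
      congr 2
      linarith [Int.floor_add_fract (t i)]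

theorem HasWeakHorseshoeBGH.flow {M : Type*} [TopologicalSpace M] {φ : M × ℝ → M}
    {h0 : ∀ x, φ (x, 0) = x}
    {hadd : ∀ (x : M) (t s : ℝ), φ (φ (x, s), t) = φ (x, t + s)}
    (h : HasWeakHorseshoeBGH (flowMap φ h0 hadd 1)) : FlowHasWeakHorseshoeBGH φ := by
  obtain ⟨U, K, n, hUc, hUn, hUd, hK, hn, hs⟩ := h
  refine ⟨U, K, 1 / 2, fun i => n i, hUc, hUn, hUd, by exact_mod_cast hK, by norm_num,
    fun i => ?_, fun s => ?_⟩
  · have : (1 : ℝ) ≤ n (i + 1) - n i := by exact_mod_cast (hn i).1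
    have : (n (i + 1) - n i : ℝ) < K := by exact_mod_cast (hn i).2
    constructor <;> linarith
  · obtain ⟨x, hx⟩ := hs fun j => s j
    exact ⟨x, fun i => by simpa only [flowMap_one_zpow] using hx i⟩

/-- A flow on a compact metric space has a weak horseshoe with bounded-gap-hitting times
if and only if its time-one map does. -/
theorem flow_hasWeakHorseshoeBGH_iff_time_one_map {M : Type*} [MetricSpace M] [CompactSpace M]
    (φ : M × ℝ → M) (hφ : Continuous φ)
    (h0 : ∀ x, φ (x, 0) = x)
    (hadd : ∀ (x : M) (t s : ℝ), φ (φ (x, s), t) = φ (x, t + s)) :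
    FlowHasWeakHorseshoeBGH φ ↔ HasWeakHorseshoeBGH (flowMap φ h0 hadd 1) := by
  exact ⟨fun h => h.time_one_map hφ h0 hadd, fun h => h.flow⟩
end

section
/- Let T be a homeomorphism of a compact metric space X. If (X,T) has a weak horseshoe with bounded-gap-hitting times, then (X,T) is not uniquely ergodic, i.e., there exist at least two distinct T-invariant Borel probability measures on X. -/
open MeasureTheory Filter Topology

/-- The uniform probability measure on the first `n + 1` points of the orbit of `x`. -/
noncomputable def empiricalMeasure {X : Type*} [MeasurableSpace X] (f : X → X) (x : X) (n : ℕ) :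
    Measure X :=
  ((n + 1 : ℕ) : ENNReal)⁻¹ • ∑ i ∈ Finset.range (n + 1), Measure.dirac (f^[i] x)

lemma isProbabilityMeasure_empiricalMeasure {X : Type*} [MeasurableSpace X] (f : X → X) (x : X)
    (n : ℕ) : IsProbabilityMeasure (empiricalMeasure f x n) := by
  constructor
  simp only [empiricalMeasure, Measure.smul_apply, Measure.finsetSum_apply, measure_univ,
    Finset.sum_const, Finset.card_range, smul_eq_mul, nsmul_eq_mul, mul_one]
  exact ENNReal.inv_mul_cancel (by positivity) (ENNReal.natCast_ne_top _)

lemma integral_empiricalMeasure {X : Type*} [MeasurableSpace X] [TopologicalSpace X]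
    [OpensMeasurableSpace X] (f : X → X) (x : X) (n : ℕ) (g : BoundedContinuousFunction X ℝ) :
    ∫ y, g y ∂(empiricalMeasure f x n) = birkhoffAverage ℝ f g (n + 1) x := by
  rw [empiricalMeasure, integral_smul_measure,
    integral_finsetSum_measure fun i _ => g.integrable _]
  simp only [birkhoffAverage, birkhoffSum, ENNReal.toReal_inv, ENNReal.toReal_natCast]
  congr 1
  exact Finset.sum_congr rfl fun i _ =>
    integral_dirac' _ _ g.continuous.measurable.stronglyMeasurable

/-- **Krylov–Bogoliubov**: the orbit of `x` produces an invariant probability measure which does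
not charge any open set missed by the orbit. -/
lemma exists_isProbabilityMeasure_map_eq_of_orbit {X : Type*} [MetricSpace X] [CompactSpace X]
    [MeasurableSpace X] [BorelSpace X] {f : X → X} (hf : Continuous f) (x : X) :
    ∃ μ : Measure X, IsProbabilityMeasure μ ∧ μ.map f = μ ∧
      ∀ W : Set X, IsOpen W → (∀ i, f^[i] x ∉ W) → μ W = 0 := by
  let p : ℕ → ProbabilityMeasure X := fun n =>
    ⟨empiricalMeasure f x n, isProbabilityMeasure_empiricalMeasure f x n⟩
  obtain ⟨μ, -, hμ⟩ := isCompact_univ.ultrafilter_le_nhds ((hyperfilter ℕ).map p) (by simp)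
  have hlim : Tendsto p (hyperfilter ℕ : Filter ℕ) (𝓝 μ) := hμ
  refine ⟨μ, inferInstance, ?_, fun W hW hx => ?_⟩
  · have : IsProbabilityMeasure ((μ : Measure X).map f) :=
      Measure.isProbabilityMeasure_map hf.measurable.aemeasurable
    refine ext_of_forall_integral_eq_of_IsFiniteMeasure fun g => ?_
    rw [integral_map hf.measurable.aemeasurable
      g.continuous.measurable.stronglyMeasurable.aestronglyMeasurable]
    have hint := ProbabilityMeasure.tendsto_iff_forall_integral_tendsto.1 hlim
    have h₁ := hint g
    have h₂ := hint (g.compContinuous ⟨f, hf⟩)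
    simp only [p, ProbabilityMeasure.coe_mk, integral_empiricalMeasure] at h₁ h₂
    have h₀ : Tendsto (fun n => birkhoffAverage ℝ f g (n + 1) (f x) -
        birkhoffAverage ℝ f g (n + 1) x) (hyperfilter ℕ : Filter ℕ) (𝓝 0) := by
      refine Tendsto.mono_left ?_ Nat.hyperfilter_le_atTop
      exact (tendsto_birkhoffAverage_apply_sub_birkhoffAverage ℝ
        ((g.isBounded_range).subset
          (Set.range_comp_subset_range _ g))).comp (tendsto_add_atTop_nat 1)
    have h₃ : ∀ n, birkhoffAverage ℝ f (g.compContinuous ⟨f, hf⟩) (n + 1) x =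
        birkhoffAverage ℝ f g (n + 1) (f x) := fun n => by
      simp [birkhoffAverage, birkhoffSum, ← Function.iterate_succ_apply,
        Function.iterate_succ_apply']
    simp only [h₃] at h₂
    exact sub_eq_zero.1 (tendsto_nhds_unique (h₂.sub h₁) h₀)
  · have h := ProbabilityMeasure.le_liminf_measure_open_of_tendsto hlim hW
    have hp : ∀ n, (p n : Measure X) W = 0 := fun n => by
      simp [p, empiricalMeasure, hW.measurableSet, hx]
    simpa [hp] using h

/-- If fewer than `2 ^ b` binary words are forbidden on each block of length `b` of `ℤ`, then some
binary sequence avoids them all. -/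
lemma exists_forall_block_ne {M b : ℕ} (hM : M < 2 ^ b) (F : ℤ → Fin M → ℤ → Fin 2) :
    ∃ w : ℤ → Fin 2, ∀ k r, ∃ q : ℤ, k * b ≤ q ∧ q < k * b + b ∧ w q ≠ F k r q := by
  have hw : ∀ k : ℤ, ∃ v : Fin b → Fin 2, ∀ r, (fun t : Fin b => F k r (k * b + t)) ≠ v := by
    intro k
    by_contra! hv
    have hcard := Fintype.card_le_of_surjective
      (fun r : Fin M => fun t : Fin b => F k r (k * b + t)) hv
    simp at hcard
    omega
  choose v hv using hw
  refine ⟨fun q => if h : (q % b).toNat < b then v (q / b) ⟨(q % b).toNat, h⟩ else 0,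
    fun k r => ?_⟩
  obtain ⟨t, ht⟩ := Function.ne_iff.1 (hv k r)
  have htb : (t : ℤ) < b := by exact_mod_cast t.2
  refine ⟨k * b + t, by omega, by omega, ?_⟩
  have hmod : (k * b + t) % (b : ℤ) = t := by
    rw [add_comm, Int.add_mul_emod_self_right]
    exact Int.emod_eq_of_lt (by positivity) htb
  have hdiv : (k * b + t) / (b : ℤ) = k := by
    rw [add_comm, Int.add_mul_ediv_right _ _ (by omega),
      Int.ediv_eq_zero_of_lt (by positivity) htb, zero_add]
  simp only [hmod, hdiv, Int.toNat_natCast, t.2, dite_true]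
  exact ht.symm

/-- A sequence of integers with gaps smaller than `K` meets every interval of length `K`. -/
lemma exists_mem_Ico_of_bounded_gaps {K : ℤ} {n : ℤ → ℤ}
    (hn : ∀ i, 0 < n (i + 1) - n i ∧ n (i + 1) - n i < K) (c : ℤ) :
    ∃ i, n i ∈ Set.Ico c (c + K) := by
  have hmono : Monotone fun i => n i - i :=
    monotone_int_of_le_succ fun i => by have := hn i; omega
  obtain ⟨i, hi, hmax⟩ := Int.exists_greatest_of_bdd (P := fun i => n i < c)
    ⟨max 0 (c - n 0), fun z hz => by
      by_contra! h
      have := hmono (show 0 ≤ z by omega)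
      simp only at this
      omega⟩
    ⟨min 0 (c - n 0 - 1), by
      have := hmono (min_le_left 0 (c - n 0 - 1))
      simp only at this
      omega⟩
  have h := hn i
  refine ⟨i + 1, ?_, by omega⟩
  by_contra! hlt
  have := hmax _ hlt
  omega

lemma continuous_perm_zpow {X : Type*} [TopologicalSpace X] {T : Equiv.Perm X} (hT : Continuous T)
    (hT' : Continuous T.symm) (m : ℤ) : Continuous (T ^ m : Equiv.Perm X) := by
  cases m with
  | ofNat m =>
    rw [Int.ofNat_eq_natCast, zpow_natCast, ← Equiv.Perm.iterate_eq_pow]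
    exact hT.iterate m
  | negSucc m =>
    rw [zpow_negSucc, ← inv_pow, ← Equiv.Perm.iterate_eq_pow]
    exact hT'.iterate (m + 1)

/-- In a system with a weak horseshoe with bounded-gap-hitting times, every point has an open
neighbourhood which is missed by some orbit. -/
lemma HasWeakHorseshoeBGH.exists_isOpen_orbit_notMem {X : Type*} [TopologicalSpace X]
    {T : Equiv.Perm X} (hT : Continuous T) (hT' : Continuous T.symm) (h : HasWeakHorseshoeBGH T)
    (y : X) : ∃ W : Set X, IsOpen W ∧ y ∈ W ∧ ∃ x, ∀ i, T^[i] x ∉ W := by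
  classical
  obtain ⟨U, K, n, hcl, -, hdisj, hK, hn, hs⟩ := h
  lift K to ℕ using hK.le
  replace hK : 0 < K := by exact_mod_cast hK
  obtain ⟨b, hb, hKb⟩ : ∃ b, 0 < b ∧ K * b < 2 ^ b := by
    refine ⟨4 * K, by omega, ?_⟩
    calc K * (4 * K) = (2 * K) ^ 2 := by ring
      _ < (2 ^ (2 * K)) ^ 2 := Nat.pow_lt_pow_left Nat.lt_two_pow_self two_ne_zero
      _ = 2 ^ (4 * K) := by rw [← pow_mul]; congr 1; ring
  set M := K * b with hMdef
  have hM : 0 < M := Nat.mul_pos hK hb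
  have hMz : (M : ℤ) = K * b := by rw [hMdef]; push_cast; rfl
  choose c hc using fun q : ℤ => exists_mem_Ico_of_bounded_gaps hn (q * K)
  let u : ℤ → Fin 2 := fun m => if (T ^ m) y ∈ U 1 then 1 else 0
  obtain ⟨w, hw⟩ := exists_forall_block_ne hKb fun k r q => u (n (c q) - k * M + r)
  obtain ⟨x, hx⟩ := hs fun j => w (j / K)
  refine ⟨⋂ m ∈ Finset.Ico (0 : ℤ) (2 * M), (T ^ m : Equiv.Perm X) ⁻¹' (U (1 - u m))ᶜ, ?_, ?_, x,
    fun a ha => ?_⟩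
  · exact isOpen_biInter_finset fun m _ =>
      (hcl _).isOpen_compl.preimage (continuous_perm_zpow hT hT' m)
  · simp only [Set.mem_iInter, Set.mem_preimage, Set.mem_compl_iff]
    intro m _
    by_cases hm : (T ^ m) y ∈ U 1
    · simpa [u, hm] using Set.disjoint_right.1 hdisj hm
    · simp [u, hm]
  · have hMz' : (0 : ℤ) < M := by exact_mod_cast hM
    obtain ⟨k, r, hkr⟩ : ∃ (k : ℤ) (r : Fin M), k * M = a + (r : ℤ) := by
      refine ⟨-(-(a : ℤ) / M), ⟨(-(a : ℤ) % M).toNat, ?_⟩, ?_⟩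
      · have := Int.emod_lt_of_pos (-(a : ℤ)) hMz'
        omega
      · have h₁ := Int.emod_nonneg (-(a : ℤ)) hMz'.ne'
        have h₂ := Int.mul_ediv_add_emod (-(a : ℤ)) M
        simp only [Int.toNat_of_nonneg h₁]
        linarith
    obtain ⟨q, hq₁, hq₂, hq⟩ := hw k r
    obtain ⟨hc₁, hc₂⟩ := hc q
    have hr : (r : ℤ) < M := by exact_mod_cast r.2
    have hr₀ : (0 : ℤ) ≤ (r : ℤ) := by positivity
    have hlow : k * M ≤ n (c q) := by
      rw [hMz]
      nlinarith
    have hupp : n (c q) < k * M + M := by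
      have : (q + 1) * (K : ℤ) ≤ (k * b + b) * K :=
        mul_le_mul_of_nonneg_right (by omega) (by positivity)
      rw [hMz]
      linarith
    have hm : n (c q) - k * M + r = n (c q) - a := by omega
    rw [hm] at hq
    have hmem := hx (c q)
    have hdiv : n (c q) / (K : ℤ) = q := by
      rw [Int.ediv_eq_iff_of_pos (by exact_mod_cast hK)]
      constructor <;> linarith
    simp only [hdiv] at hmem
    have hflip : ∀ i j : Fin 2, i ≠ j → i = 1 - j := by decide
    rw [hflip _ _ hq] at hmem
    simp only [Set.mem_iInter, Set.mem_preimage, Set.mem_compl_iff] at ha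
    refine ha (n (c q) - a) (Finset.mem_Ico.2 ⟨by omega, by omega⟩) ?_
    rwa [Equiv.Perm.iterate_eq_pow, ← zpow_natCast, ← Equiv.Perm.mul_apply, ← zpow_add,
      sub_add_cancel]

/-- A homeomorphism of a compact metric space with a weak horseshoe with
bounded-gap-hitting times is not uniquely ergodic: there are at least two distinct
`T`-invariant Borel probability measures. -/
theorem hasWeakHorseshoeBGH_not_uniquelyErgodic {X : Type*} [MetricSpace X] [CompactSpace X]
    [MeasurableSpace X] [BorelSpace X]
    (T : Equiv.Perm X) (hT : Continuous T) (hT' : Continuous T.symm)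
    (h : HasWeakHorseshoeBGH T) :
    ∃ μ ν : MeasureTheory.Measure X,
      MeasureTheory.IsProbabilityMeasure μ ∧ MeasureTheory.IsProbabilityMeasure ν ∧
      μ.map T = μ ∧ ν.map T = ν ∧ μ ≠ ν := by
  obtain ⟨x₀, -⟩ : ∃ x : X, x ∈ Set.univ := by
    obtain ⟨U, -, -, -, hne, -⟩ := h
    exact ⟨(hne 0).some, trivial⟩
  obtain ⟨μ, hμ, hμT, -⟩ := exists_isProbabilityMeasure_map_eq_of_orbit hT x₀
  obtain ⟨y, hy⟩ := Measure.nonempty_support hμ.ne_zero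
  obtain ⟨W, hW, hyW, x, hx⟩ := h.exists_isOpen_orbit_notMem hT hT' y
  obtain ⟨ν, hν, hνT, hν₀⟩ := exists_isProbabilityMeasure_map_eq_of_orbit hT x
  refine ⟨μ, ν, hμ, hν, hμT, hνT, ?_⟩
  rintro rfl
  exact ((Measure.mem_support_iff_forall y).1 hy W (hW.mem_nhds hyW)).ne' (hν₀ W hW hx)
end
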